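/- Palm–Khinchin equations for the j-th entry and return times: let 𝔓 be a stationary simple point process on ℝ with intensity I ∈ (0,∞) and Palm distribution Q. Then for every integer j ≥ 1 and every R ≥ 0, 𝔓({ζ : ζ ≠ 0 and τ_j(ζ) > R}) = I · ∫_R^∞ ( Q({η : τ_j(η) > u}) − Q({η : τ_{j−1}(η) > u}) ) du, the integrand being nonnegative since τ_{j−1} ≤ τ_j. -/

import Mathlib

open MeasureTheory Set Filter
open scoped ENNReal

/-- The shift `θ^u` on Borel measures on `ℝ`: `(θ^u ζ)(B) = ζ(B + u)`. -/
noncomputable def shift (u : ℝ) (ζ : Measure ℝ) : Measure ℝ :=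
  Measure.map (fun t => t - u) ζ

/-- `𝔓` is stationary: the pushforward of `𝔓` under `θ^u` equals `𝔓` for every `u ∈ ℝ`. -/
def IsStationaryPP (P : Measure (Measure ℝ)) : Prop :=
  ∀ u : ℝ, Measure.map (shift u) P = P

/-- `𝔓` is a simple point process: `𝔓`-a.e. `ζ` is `ℕ`-valued on bounded Borel sets and has
no multiple points. -/
def IsSimplePP (P : Measure (Measure ℝ)) : Prop :=
  ∀ᵐ ζ ∂P, (∀ B : Set ℝ, Bornology.IsBounded B → MeasurableSet B → ∃ n : ℕ, ζ B = (n : ℝ≥0∞)) ∧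
    ∀ t : ℝ, ζ ({t} : Set ℝ) ≤ 1

/-- The intensity `I = ∫ ζ((0,1]) d𝔓(ζ)` of a stationary point process. -/
noncomputable def intensity (P : Measure (Measure ℝ)) : ℝ≥0∞ :=
  ∫⁻ ζ, ζ (Set.Ioc (0 : ℝ) 1) ∂P

/-- `Q` is the Palm distribution of `𝔓`:
`∫ f dQ = I⁻¹ ∫ (∫_{(0,1]} f(θ^u ζ) ζ(du)) d𝔓(ζ)` for all measurable `f : M(ℝ) → [0,∞]`. -/
def IsPalm (P Q : Measure (Measure ℝ)) : Prop :=
  ∀ f : Measure ℝ → ℝ≥0∞, Measurable f →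
    ∫⁻ η, f η ∂Q = (intensity P)⁻¹ * ∫⁻ ζ, (∫⁻ u in Set.Ioc (0 : ℝ) 1, f (shift u ζ) ∂ζ) ∂P

/-- `τ_j(ζ) = inf {t > 0 : ζ((0,t]) ≥ j} ∈ (0,∞]` for `j ≥ 1` (with `inf ∅ = ∞`),
and `τ_0(ζ) = 0`. -/
noncomputable def tau (j : ℕ) (ζ : Measure ℝ) : ℝ≥0∞ :=
  if j = 0 then 0
  else sInf ((fun s : ℝ => ENNReal.ofReal s) '' {s : ℝ | 0 < s ∧ (j : ℝ≥0∞) ≤ ζ (Set.Ioc 0 s)})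

open ProbabilityTheory

/-- Locally finite measures. -/
def GoodM (ζ : Measure ℝ) : Prop := ∀ n : ℕ, ζ (Icc (-(n : ℝ)) n) < ⊤

lemma GoodM.lt_top {ζ : Measure ℝ} (h : GoodM ζ) {B : Set ℝ} (hB : Bornology.IsBounded B) :
    ζ B < ⊤ := by
  obtain ⟨r, hr⟩ := hB.subset_closedBall 0
  obtain ⟨n, hn⟩ := exists_nat_ge r
  refine lt_of_le_of_lt (measure_mono ?_) (h n)
  intro x hx
  have := hr hx
  rw [Real.closedBall_eq_Icc] at this
  constructor <;> linarith [this.1, this.2]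

lemma measurableSet_good : MeasurableSet {ζ : Measure ℝ | GoodM ζ} := by
  simp only [GoodM, Set.ofPred_forall]
  exact MeasurableSet.iInter fun n =>
    measurableSet_lt (Measure.measurable_coe measurableSet_Icc) measurable_const

lemma shift_apply (u : ℝ) (ζ : Measure ℝ) {B : Set ℝ} (hB : MeasurableSet B) :
    shift u ζ B = ζ ((fun t => t - u) ⁻¹' B) :=
  Measure.map_apply (by fun_prop) hB

lemma shift_Ioc (u : ℝ) (ζ : Measure ℝ) (a b : ℝ) :
    shift u ζ (Ioc a b) = ζ (Ioc (a + u) (b + u)) := by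
  rw [shift_apply _ _ measurableSet_Ioc]; simp

lemma measurable_shift (u : ℝ) : Measurable (shift u) :=
  Measure.measurable_map _ (by fun_prop)

lemma GoodM.shift {ζ : Measure ℝ} (h : GoodM ζ) (u : ℝ) : GoodM (shift u ζ) := by
  intro n
  rw [shift_apply _ _ measurableSet_Icc]
  apply h.lt_top
  simpa using Metric.isBounded_Icc _ _

/-- pieces of the kernel -/
noncomputable def piece (m : ℤ) (k : ℕ) : Kernel (Measure ℝ) ℝ where
  toFun := {ζ : Measure ℝ | ζ (Ioc (m : ℝ) (m + 1)) ∈ Ico (k : ℝ≥0∞) (k + 1)}.indicator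
    fun ζ => ζ.restrict (Ioc (m : ℝ) (m + 1))
  measurable' := by
    refine Measurable.indicator ?_ ?_
    · refine Measure.measurable_of_measurable_coe _ fun s hs => ?_
      simp_rw [Measure.restrict_apply hs]
      exact Measure.measurable_coe (hs.inter measurableSet_Ioc)
    exact (Measure.measurable_coe measurableSet_Ioc) measurableSet_Ico

lemma piece_apply (m : ℤ) (k : ℕ) (ζ : Measure ℝ) : piece m k ζ =
  {ζ : Measure ℝ | ζ (Ioc (m : ℝ) (m + 1)) ∈ Ico (k : ℝ≥0∞) (k + 1)}.indicator
    (fun ζ => ζ.restrict (Ioc (m : ℝ) (m + 1))) ζ := rfl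

instance (m : ℤ) (k : ℕ) : IsFiniteKernel (piece m k) := by
  refine ⟨⟨k + 1, by finiteness, fun ζ => ?_⟩⟩
  rw [piece_apply]
  by_cases h : ζ (Ioc (m : ℝ) (m + 1)) ∈ Ico (k : ℝ≥0∞) (k + 1)
  · rw [indicator_of_mem (by simpa using h)]
    simpa using h.2.le
  · rw [indicator_of_notMem (by simpa using h)]; simp

/-- An s-finite kernel which is the identity on locally finite measures. -/
noncomputable def kap : Kernel (Measure ℝ) ℝ :=
  Kernel.sum fun m : ℤ => Kernel.sum fun k : ℕ => piece m k

instance : IsSFiniteKernel kap := by unfold kap; infer_instance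

lemma kap_eq {ζ : Measure ℝ} (h : GoodM ζ) : kap ζ = ζ := by
  have h1 : ∀ m : ℤ, Kernel.sum (fun k : ℕ => piece m k) ζ = ζ.restrict (Ioc (m : ℝ) (m + 1)) := by
    intro m
    have hf : ζ (Ioc (m : ℝ) (m + 1)) ≠ ⊤ := (h.lt_top (Metric.isBounded_Ioc _ _)).ne
    ext s hs
    rw [Kernel.sum_apply, Measure.sum_apply _ hs]
    generalize hx : ζ (Ioc (m : ℝ) (m + 1)) = x at hf
    have key : ∀ k : ℕ, x ∈ Ico (k : ℝ≥0∞) (k + 1) ↔ k = ⌊x.toReal⌋₊ := by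
      intro k
      rw [eq_comm, Nat.floor_eq_iff ENNReal.toReal_nonneg]
      clear hx
      lift x to NNReal using hf
      simp only [mem_Ico, ENNReal.coe_toReal]
      norm_cast
    rw [tsum_eq_single ⌊x.toReal⌋₊]
    · rw [piece_apply, indicator_of_mem]
      rw [mem_ofPred_eq, hx]
      exact (key _).2 rfl
    · intro k hk
      rw [piece_apply, indicator_of_notMem]
      · rfl
      · rw [mem_ofPred_eq, hx]
        exact fun hh => hk ((key _).1 hh)
  unfold kap
  rw [Kernel.sum_apply]
  simp_rw [h1]
  rw [← Measure.restrict_iUnion (pairwise_disjoint_Ioc_intCast ℝ) (fun _ => measurableSet_Ioc),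
    iUnion_Ioc_intCast, Measure.restrict_univ]

lemma meas_kap {X : Type*} [MeasurableSpace X] {g : X → Measure ℝ} (hg : Measurable g)
    {f : X → ℝ → ℝ≥0∞} (hf : Measurable (Function.uncurry f)) :
    Measurable fun x => ∫⁻ t, f x t ∂(kap (g x)) := by
  have := Measurable.lintegral_kernel_prod_right (κ := kap.comap g hg) hf
  simpa [Kernel.comap_apply] using this

lemma meas_kap_Ioc : Measurable fun p : Measure ℝ × ℝ × ℝ => kap p.1 (Ioc p.2.1 p.2.2) := by
  have : ∀ p : Measure ℝ × ℝ × ℝ, kap p.1 (Ioc p.2.1 p.2.2) =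
      ∫⁻ t, {q : (Measure ℝ × ℝ × ℝ) × ℝ | q.1.2.1 < q.2 ∧ q.2 ≤ q.1.2.2}.indicator 1 (p, t)
        ∂(kap p.1) := by
    intro p
    rw [← lintegral_indicator_one measurableSet_Ioc]
    rfl
  simp_rw [this]
  refine meas_kap measurable_fst (f := fun p t =>
    {q : (Measure ℝ × ℝ × ℝ) × ℝ | q.1.2.1 < q.2 ∧ q.2 ≤ q.1.2.2}.indicator 1 (p, t)) ?_
  refine Measurable.indicator measurable_one ?_
  have h1 : MeasurableSet {q : (Measure ℝ × ℝ × ℝ) × ℝ | q.1.2.1 < q.2} :=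
    measurableSet_lt (by fun_prop) (by fun_prop)
  have h2 : MeasurableSet {q : (Measure ℝ × ℝ × ℝ) × ℝ | q.2 ≤ q.1.2.2} :=
    measurableSet_le (by fun_prop) (by fun_prop)
  exact h1.inter h2

lemma swap3 (P : Measure (Measure ℝ)) [SFinite P] {f : Measure ℝ → ℝ → ℝ → ℝ≥0∞}
    (hf : Measurable fun p : Measure ℝ × ℝ × ℝ => f p.1 p.2.1 p.2.2) :
    ∫⁻ v, ∫⁻ ζ, ∫⁻ s, f ζ s v ∂(kap ζ) ∂P = ∫⁻ ζ, ∫⁻ s, ∫⁻ v, f ζ s v ∂volume ∂(kap ζ) ∂P := by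
  rw [lintegral_lintegral_swap]
  · refine lintegral_congr fun ζ => ?_
    rw [lintegral_lintegral_swap]
    exact (hf.comp (f := fun q : ℝ × ℝ => (ζ, q.2, q.1)) (by fun_prop)).aemeasurable
  · refine Measurable.aemeasurable ?_
    refine meas_kap (g := fun q : ℝ × Measure ℝ => q.2) measurable_snd
      (f := fun q s => f q.2 s q.1) ?_
    exact hf.comp (f := fun q : (ℝ × Measure ℝ) × ℝ => (q.1.2, q.2, q.1.1)) (by fun_prop)

/-- the basic event -/
def Gset (j : ℕ) (R : ℝ) : Set (Measure ℝ × ℝ × ℝ) :=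
  {p | p.2.1 + R ≤ p.2.2 ∧ kap p.1 (Ioc p.2.1 p.2.2) ∈ Ico ((j - 1 : ℕ) : ℝ≥0∞) j}

lemma measurableSet_Gset (j : ℕ) (R : ℝ) : MeasurableSet (Gset j R) := by
  have h1 : MeasurableSet {p : Measure ℝ × ℝ × ℝ | p.2.1 + R ≤ p.2.2} :=
    measurableSet_le (by fun_prop) (by fun_prop)
  exact h1.inter (meas_kap_Ioc measurableSet_Ico)

/-- its indicator -/
noncomputable def hG (j : ℕ) (R : ℝ) (ζ : Measure ℝ) (s v : ℝ) : ℝ≥0∞ :=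
  (Gset j R).indicator 1 (ζ, s, v)

lemma measurable_hG (j : ℕ) (R : ℝ) :
    Measurable fun p : Measure ℝ × ℝ × ℝ => hG j R p.1 p.2.1 p.2.2 :=
  Measurable.indicator measurable_one (measurableSet_Gset j R)

lemma lt_tau_iff {ζ : Measure ℝ} (h : GoodM ζ) (j : ℕ) {u : ℝ} (hu : 0 ≤ u) :
    ENNReal.ofReal u < tau j ζ ↔ ζ (Ioc 0 u) < j := by
  rcases Nat.eq_zero_or_pos j with rfl | hj
  · simp [tau]
  rw [tau, if_neg hj.ne']
  constructor
  · intro hlt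
    by_contra! hge
    have hu0 : 0 < u := by
      by_contra! hle
      rw [Ioc_eq_empty (by simpa using hle), measure_empty] at hge
      simp at hge
      omega
    exact absurd hlt (not_lt.2 (sInf_le ⟨u, ⟨hu0, hge⟩, rfl⟩))
  · intro hlt
    have hanti : Antitone fun n : ℕ => Ioc (0 : ℝ) (u + 1 / ((n : ℝ) + 1)) := by
      intro m n hmn
      exact Ioc_subset_Ioc_right (by gcongr)
    have hI : ⋂ n : ℕ, Ioc (0 : ℝ) (u + 1 / ((n : ℝ) + 1)) = Ioc 0 u := by
      ext x
      simp only [mem_iInter, mem_Ioc]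
      constructor
      · intro hx
        refine ⟨(hx 0).1, le_of_forall_pos_le_add fun ε hε => ?_⟩
        obtain ⟨n, hn⟩ := exists_nat_one_div_lt hε
        linarith [(hx n).2]
      · intro hx n
        exact ⟨hx.1, hx.2.trans (by simp; positivity)⟩
    have ht := tendsto_measure_iInter_atTop (μ := ζ) (fun n => measurableSet_Ioc.nullMeasurableSet)
      hanti ⟨0, (h.lt_top (Metric.isBounded_Ioc _ _)).ne⟩
    rw [hI] at ht
    obtain ⟨n, hn⟩ := (ht.eventually (gt_mem_nhds hlt)).exists
    have hpos : (0 : ℝ) < 1 / ((n : ℝ) + 1) := by positivity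
    refine lt_of_lt_of_le ((ENNReal.ofReal_lt_ofReal_iff (by linarith)).2
      (show u < u + 1 / ((n : ℝ) + 1) by linarith)) ?_
    refine le_sInf ?_
    rintro _ ⟨s, ⟨hs0, hs⟩, rfl⟩
    refine ENNReal.ofReal_le_ofReal ?_
    by_contra! hlt'
    refine absurd (hs.trans (measure_mono (Ioc_subset_Ioc_right hlt'.le))) (not_le.2 hn)

/-- simple integer valued -/
def SimpleM (ζ : Measure ℝ) : Prop :=
  (∀ B : Set ℝ, Bornology.IsBounded B → MeasurableSet B → ∃ n : ℕ, ζ B = (n : ℝ≥0∞)) ∧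
    ∀ t : ℝ, ζ ({t} : Set ℝ) ≤ 1

lemma SimpleM.good {ζ : Measure ℝ} (h : SimpleM ζ) : GoodM ζ := by
  intro n
  obtain ⟨k, hk⟩ := h.1 (Icc (-(n : ℝ)) n) (Metric.isBounded_Icc _ _) measurableSet_Icc
  rw [hk]; finiteness

lemma recur (P : Measure (Measure ℝ)) [IsProbabilityMeasure P]
    (hstat : IsStationaryPP P) (hsimple : IsSimplePP P) :
    ∀ᵐ ζ ∂P, ζ = 0 ∨ ζ (Iic 0) = ⊤ := by
  let E : ℤ → Set (Measure ℝ) := fun t => {ζ | ζ (Iic (t : ℝ)) ≠ 0}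
  have hEm : ∀ t, MeasurableSet (E t) := fun t =>
    (Measure.measurable_coe measurableSet_Iic) (measurableSet_singleton (0 : ℝ≥0∞)).compl
  have hE : ∀ t, P (E t) = P (E 0) := by
    intro t
    conv_rhs => rw [← hstat t]
    rw [Measure.map_apply (measurable_shift _) (hEm 0)]
    congr 1
    ext ζ
    simp only [E, mem_preimage, mem_ofPred_eq]
    rw [shift_apply _ _ measurableSet_Iic]
    simp
  have hmono : Monotone E := by
    intro a b hab ζ hζ h0
    exact hζ (measure_mono_null (Iic_subset_Iic.2 (by exact_mod_cast hab)) h0)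
  have hae : ∀ᵐ ζ ∂P, ∀ m n : ℤ, ζ ∈ E n → ζ ∈ E m := by
    rw [ae_all_iff]; intro m
    rw [ae_all_iff]; intro n
    rcases le_total n m with hnm | hmn
    · exact Eventually.of_forall fun ζ h => hmono hnm h
    · have := ae_eq_of_subset_of_measure_ge (hmono hmn) (by rw [hE n, hE m])
        (hEm m).nullMeasurableSet (measure_ne_top P _)
      filter_upwards [this.mem_iff] with ζ h
      exact h.2
  filter_upwards [hae, hsimple] with ζ h1 h2
  have hs : SimpleM ζ := h2
  by_contra! hcon
  obtain ⟨hne, hfin⟩ := hcon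
  obtain ⟨n, hn⟩ : ∃ n : ℤ, ζ ∈ E n := by
    by_contra! hall
    apply hne
    rw [← Measure.measure_univ_eq_zero]
    have : (univ : Set ℝ) = ⋃ n : ℤ, Iic (n : ℝ) := by
      symm
      rw [eq_univ_iff_forall]
      intro x
      exact mem_iUnion.2 ⟨⌈x⌉, Int.le_ceil x⟩
    rw [this, measure_iUnion_null_iff]
    intro i
    by_contra hi
    exact hall i hi
  have hge : ∀ m : ℕ, 1 ≤ ζ (Iic (-(m : ℝ))) := by
    intro m
    have hm : ζ (Iic (-(m : ℝ))) ≠ 0 := by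
      have := h1 (-m) n hn
      simpa [E] using this
    have hU : Iic (-(m : ℝ)) = ⋃ k : ℕ, Icc (-(k : ℝ)) (-m) := by
      ext x
      simp only [mem_iUnion, mem_Icc, mem_Iic]
      constructor
      · intro hx
        obtain ⟨k, hk⟩ := exists_nat_ge (-x)
        exact ⟨k, by linarith, hx⟩
      · rintro ⟨k, _, hx⟩; exact hx
    rw [hU, Ne, measure_iUnion_null_iff, not_forall] at hm
    obtain ⟨k, hk⟩ := hm
    obtain ⟨c, hc⟩ := hs.1 (Icc (-(k : ℝ)) (-m)) (Metric.isBounded_Icc _ _) measurableSet_Icc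
    have : 1 ≤ ζ (Icc (-(k : ℝ)) (-m)) := by
      rw [hc] at hk ⊢
      have : c ≠ 0 := by simpa using hk
      exact_mod_cast Nat.one_le_iff_ne_zero.2 this
    exact this.trans (measure_mono fun x hx => hx.2)
  have ht := tendsto_measure_iInter_atTop (μ := ζ) (s := fun m : ℕ => Iic (-(m : ℝ)))
    (fun n => measurableSet_Iic.nullMeasurableSet)
    (fun a b hab => Iic_subset_Iic.2 (by simpa using hab)) ⟨0, by simpa using hfin⟩
  have hI : ⋂ m : ℕ, Iic (-(m : ℝ)) = ∅ := by
    rw [eq_empty_iff_forall_notMem]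
    intro x hx
    obtain ⟨k, hk⟩ := exists_nat_gt (-x)
    have := mem_iInter.1 hx k
    simp only [mem_Iic] at this
    linarith
  rw [hI, measure_empty] at ht
  exact absurd (ge_of_tendsto' ht hge) (by simp)

lemma path {ζ : Measure ℝ} (hs : SimpleM ζ) (hinf : ζ (Iic 0) = ⊤) {j : ℕ} (hj : 1 ≤ j)
    {R : ℝ} (hR : 0 ≤ R) (hlt : ζ (Ioc (-R) 0) < j) :
    ζ {s | s + R ≤ 0 ∧ ζ (Ioc s 0) ∈ Ico ((j - 1 : ℕ) : ℝ≥0∞) j} = 1 := by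
  have hg := hs.good
  have lt_iff : ∀ B : Set ℝ, Bornology.IsBounded B → MeasurableSet B →
      (ζ B < j ↔ ζ B ≤ ((j - 1 : ℕ) : ℝ≥0∞)) := by
    intro B hB hB'
    obtain ⟨n, hn⟩ := hs.1 B hB hB'
    rw [hn]
    norm_cast
    omega
  let W : Set ℝ := {s | s ≤ 0 ∧ (j : ℝ≥0∞) ≤ ζ (Icc s 0)}
  have hWne : W.Nonempty := by
    have hU : Iic (0 : ℝ) = ⋃ k : ℕ, Icc (-(k : ℝ)) 0 := by
      ext x
      simp only [mem_iUnion, mem_Icc, mem_Iic]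
      constructor
      · intro hx
        obtain ⟨k, hk⟩ := exists_nat_ge (-x)
        exact ⟨k, by linarith, hx⟩
      · rintro ⟨k, _, hx⟩; exact hx
    have ht := tendsto_measure_iUnion_atTop (μ := ζ) (s := fun k : ℕ => Icc (-(k : ℝ)) 0)
      (fun a b hab => Icc_subset_Icc_left (by simpa using hab))
    rw [← hU, hinf] at ht
    obtain ⟨k, hk⟩ := (ht.eventually (lt_mem_nhds (ENNReal.natCast_lt_top j))).exists
    exact ⟨-k, by simp, hk.le⟩
  have hWb : BddAbove W := ⟨0, fun x hx => hx.1⟩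
  set p := sSup W with hp
  have hp0 : p ≤ 0 := csSup_le hWne fun x hx => hx.1
  have hWlow : ∀ s, s < p → (j : ℝ≥0∞) ≤ ζ (Icc s 0) := by
    intro s hsp
    obtain ⟨w, hw, hsw⟩ := exists_lt_of_lt_csSup hWne hsp
    exact hw.2.trans (measure_mono (Icc_subset_Icc_left hsw.le))
  have h1 : (j : ℝ≥0∞) ≤ ζ (Icc p 0) := by
    have ht := tendsto_measure_iInter_atTop (μ := ζ)
      (s := fun n : ℕ => Icc (p - 1 / ((n : ℝ) + 1)) 0)
      (fun n => measurableSet_Icc.nullMeasurableSet)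
      (fun a b hab => Icc_subset_Icc_left (by gcongr))
      ⟨0, (hg.lt_top (Metric.isBounded_Icc _ _)).ne⟩
    have hI : ⋂ n : ℕ, Icc (p - 1 / ((n : ℝ) + 1)) 0 = Icc p 0 := by
      ext x
      simp only [mem_iInter, mem_Icc]
      constructor
      · intro hx
        refine ⟨le_of_forall_pos_le_add fun ε hε => ?_, (hx 0).2⟩
        obtain ⟨n, hn⟩ := exists_nat_one_div_lt hε
        linarith [(hx n).1]
      · intro hx n
        exact ⟨le_trans (by simp; positivity) hx.1, hx.2⟩
    rw [hI] at ht
    refine ge_of_tendsto' ht fun n => hWlow _ ?_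
    have hpos : (0 : ℝ) < 1 / ((n : ℝ) + 1) := by positivity
    linarith
  have h2 : ζ (Ioc p 0) ≤ ((j - 1 : ℕ) : ℝ≥0∞) := by
    have ht := tendsto_measure_iUnion_atTop (μ := ζ)
      (s := fun n : ℕ => Icc (p + 1 / ((n : ℝ) + 1)) 0)
      (fun a b hab => Icc_subset_Icc_left (by gcongr))
    have hU : ⋃ n : ℕ, Icc (p + 1 / ((n : ℝ) + 1)) 0 = Ioc p 0 := by
      ext x
      simp only [mem_iUnion, mem_Icc, mem_Ioc]
      constructor
      · rintro ⟨n, h1, h2⟩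
        have hpos : (0 : ℝ) < 1 / ((n : ℝ) + 1) := by positivity
        exact ⟨by linarith, h2⟩
      · intro hx
        obtain ⟨n, hn⟩ := exists_nat_one_div_lt (sub_pos.2 hx.1)
        exact ⟨n, by linarith, hx.2⟩
    rw [hU] at ht
    refine le_of_tendsto' ht fun n => ?_
    have hpos : (0 : ℝ) < 1 / ((n : ℝ) + 1) := by positivity
    refine (lt_iff _ (Metric.isBounded_Icc _ _) measurableSet_Icc).1 ?_
    by_contra! hcon
    by_cases hle : p + 1 / ((n : ℝ) + 1) ≤ 0
    · have := le_csSup hWb (show p + 1 / ((n : ℝ) + 1) ∈ W from ⟨hle, hcon⟩)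
      linarith
    · rw [Icc_eq_empty hle, measure_empty] at hcon
      simp at hcon
      omega
  have hsplit : ζ (Icc p 0) = ζ {p} + ζ (Ioc p 0) := by
    rw [← Icc_union_Ioc_eq_Icc (le_refl p) hp0, measure_union _ measurableSet_Ioc, Icc_self]
    simp
  obtain ⟨a, ha⟩ := hs.1 {p} Bornology.isBounded_singleton (measurableSet_singleton p)
  obtain ⟨b, hb⟩ := hs.1 (Ioc p 0) (Metric.isBounded_Ioc _ _) measurableSet_Ioc
  have ha1 := hs.2 p
  rw [hsplit] at h1
  rw [ha, hb] at h1
  rw [ha] at ha1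
  rw [hb] at h2
  norm_cast at h1 h2 ha1
  have haeq : a = 1 := by omega
  have hbeq : b = j - 1 := by omega
  have hpR : p ≤ -R := by
    by_contra! hcon
    have : ζ (Icc p 0) ≤ ζ (Ioc (-R) 0) := measure_mono fun x hx => ⟨hcon.trans_le hx.1, hx.2⟩
    refine absurd (this.trans_lt hlt) (not_lt.2 ?_)
    rw [hsplit, ha, hb]; exact_mod_cast h1
  set S := {s | s + R ≤ 0 ∧ ζ (Ioc s 0) ∈ Ico ((j - 1 : ℕ) : ℝ≥0∞) j} with hS
  have hpS : p ∈ S := by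
    refine ⟨by linarith, ?_, ?_⟩
    · rw [hb, hbeq]
    · rw [hb, hbeq]; norm_cast; omega
  have hnull : ζ (S \ {p}) = 0 := by
    have hgt : ∀ x ∈ S \ {p}, p < x ∧ ζ (Ioc p x) = 0 := by
      rintro x ⟨⟨hx1, hx2, hx3⟩, hxp⟩
      have hx0 : x ≤ 0 := by linarith
      rcases lt_or_gt_of_ne hxp with hl | hl
      · exfalso
        have : ζ (Icc p 0) ≤ ζ (Ioc x 0) := measure_mono fun y hy => ⟨hl.trans_le hy.1, hy.2⟩
        refine absurd (this.trans_lt hx3) (not_lt.2 ?_)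
        rw [hsplit, ha, hb]; exact_mod_cast h1
      · refine ⟨hl, ?_⟩
        have hsp : ζ (Ioc p 0) = ζ (Ioc p x) + ζ (Ioc x 0) := by
          rw [← Ioc_union_Ioc_eq_Ioc hl.le hx0, measure_union _ measurableSet_Ioc]
          simp
        obtain ⟨c, hc⟩ := hs.1 (Ioc p x) (Metric.isBounded_Ioc _ _) measurableSet_Ioc
        obtain ⟨d, hd⟩ := hs.1 (Ioc x 0) (Metric.isBounded_Ioc _ _) measurableSet_Ioc
        rw [hb, hc, hd] at hsp
        rw [hd] at hx2
        rw [hc]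
        norm_cast at hsp hx2 ⊢
        omega
    refine measure_null_of_locally_null _ fun x hx => ?_
    by_cases hmax : ∃ y ∈ S \ {p}, x < y
    · obtain ⟨y, hy, hxy⟩ := hmax
      exact ⟨Ioc p y, mem_nhdsWithin_of_mem_nhds (Ioc_mem_nhds (hgt x hx).1 hxy), (hgt y hy).2⟩
    · push Not at hmax
      refine ⟨Ioc p x, ?_, (hgt x hx).2⟩
      exact mem_of_superset self_mem_nhdsWithin fun y hy => ⟨(hgt y hy).1, hmax y hy⟩
  refine le_antisymm ?_ ?_
  · calc ζ S ≤ ζ ({p} ∪ S \ {p}) := measure_mono (by simp)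
      _ ≤ ζ {p} + ζ (S \ {p}) := measure_union_le _ _
      _ = 1 := by rw [hnull, ha, haeq]; simp
  · calc (1 : ℝ≥0∞) = ζ {p} := by rw [ha, haeq]; simp
      _ ≤ ζ S := measure_mono (by simpa using hpS)

lemma hG_shift {ζ : Measure ℝ} (h : GoodM ζ) (j : ℕ) (R u s v : ℝ) :
    hG j R (shift u ζ) (s - u) (v - u) = hG j R ζ s v := by
  have : (shift u ζ, s - u, v - u) ∈ Gset j R ↔ (ζ, s, v) ∈ Gset j R := by
    simp only [Gset, mem_ofPred_eq]
    rw [kap_eq h, kap_eq (h.shift u), shift_Ioc, sub_add_cancel, sub_add_cancel]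
    have : s - u + R ≤ v - u ↔ s + R ≤ v := by constructor <;> intro <;> linarith
    rw [this]
  unfold hG
  by_cases hm : (ζ, s, v) ∈ Gset j R
  · rw [indicator_of_mem hm, indicator_of_mem (this.2 hm)]; rfl
  · rw [indicator_of_notMem hm, indicator_of_notMem (fun h => hm (this.1 h))]

lemma stat_step (P : Measure (Measure ℝ)) (hstat : IsStationaryPP P)
    (hgood : ∀ᵐ ζ ∂P, GoodM ζ) (j : ℕ) (R v : ℝ) :
    ∫⁻ ζ, ∫⁻ s, (Ioc (0 : ℝ) 1).indicator (fun s => hG j R ζ s v) s ∂(kap ζ) ∂P =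
    ∫⁻ ζ, ∫⁻ s, (Ioc (0 : ℝ) 1).indicator (fun _ => hG j R ζ s 0) (s + v) ∂(kap ζ) ∂P := by
  have hm : Measurable fun q : Measure ℝ × ℝ =>
      (Ioc (0 : ℝ) 1).indicator (fun _ => hG j R q.1 q.2 0) (q.2 + v) := by
    have h1 : Measurable fun q : Measure ℝ × ℝ => hG j R q.1 q.2 0 :=
      (measurable_hG j R).comp (f := fun q : Measure ℝ × ℝ => (q.1, q.2, (0 : ℝ))) (by fun_prop)
    have h2 : Measurable fun q : Measure ℝ × ℝ => q.2 + v := by fun_prop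
    exact h1.indicator (h2 measurableSet_Ioc)
  conv_rhs => rw [← hstat v]
  rw [lintegral_map (meas_kap (g := fun ζ => ζ) measurable_id (f := fun ζ s =>
    (Ioc (0 : ℝ) 1).indicator (fun _ => hG j R ζ s 0) (s + v)) hm) (measurable_shift v)]
  refine lintegral_congr_ae ?_
  filter_upwards [hgood] with ζ h
  rw [kap_eq h, kap_eq (h.shift v)]
  conv_rhs => enter [1]; rw [shift]
  have hm' : Measurable fun t : ℝ =>
      (Ioc (0 : ℝ) 1).indicator (fun _ => hG j R (shift v ζ) t 0) (t + v) :=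
    hm.comp (f := fun s => (shift v ζ, s)) (by fun_prop)
  rw [lintegral_map hm' (by fun_prop)]
  refine lintegral_congr fun s => ?_
  rw [sub_add_cancel]
  by_cases hs : s ∈ Ioc (0 : ℝ) 1
  · rw [indicator_of_mem hs, indicator_of_mem hs, ← hG_shift h j R v s v, sub_self]
  · rw [indicator_of_notMem hs, indicator_of_notMem hs]

lemma main_step (P : Measure (Measure ℝ)) [IsProbabilityMeasure P] (hstat : IsStationaryPP P)
    (hgood : ∀ᵐ ζ ∂P, GoodM ζ) (j : ℕ) (R : ℝ) :
    ∫⁻ u, ∫⁻ ζ, ∫⁻ s, (Ioc (0 : ℝ) 1).indicator (fun s => hG j R ζ s (s + u)) s ∂(kap ζ) ∂P =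
    ∫⁻ ζ, ∫⁻ s, hG j R ζ s 0 ∂(kap ζ) ∂P := by
  have hm1 : Measurable fun p : Measure ℝ × ℝ × ℝ =>
      (Ioc (0 : ℝ) 1).indicator (fun s => hG j R p.1 s p.2.2) p.2.1 := by
    have h2 : Measurable fun q : Measure ℝ × ℝ × ℝ => q.2.1 := by fun_prop
    exact (measurable_hG j R).indicator (h2 measurableSet_Ioc)
  have hm2 : Measurable fun p : Measure ℝ × ℝ × ℝ =>
      (Ioc (0 : ℝ) 1).indicator (fun s => hG j R p.1 s (s + p.2.2)) p.2.1 :=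
    hm1.comp (f := fun p : Measure ℝ × ℝ × ℝ => (p.1, p.2.1, p.2.1 + p.2.2)) (by fun_prop)
  have hm3 : Measurable fun p : Measure ℝ × ℝ × ℝ =>
      (Ioc (0 : ℝ) 1).indicator (fun _ => hG j R p.1 p.2.1 0) (p.2.1 + p.2.2) := by
    have h1 : Measurable fun q : Measure ℝ × ℝ × ℝ => hG j R q.1 q.2.1 0 :=
      (measurable_hG j R).comp (f := fun q : Measure ℝ × ℝ × ℝ => (q.1, q.2.1, (0 : ℝ)))
        (by fun_prop)
    have h2 : Measurable fun q : Measure ℝ × ℝ × ℝ => q.2.1 + q.2.2 := by fun_prop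
    exact h1.indicator (h2 measurableSet_Ioc)
  rw [swap3 P (f := fun ζ s u => (Ioc (0 : ℝ) 1).indicator (fun s => hG j R ζ s (s + u)) s) hm2]
  have e1 : ∀ (ζ : Measure ℝ) (s : ℝ),
      ∫⁻ u, (Ioc (0 : ℝ) 1).indicator (fun s => hG j R ζ s (s + u)) s =
      ∫⁻ v, (Ioc (0 : ℝ) 1).indicator (fun s => hG j R ζ s v) s := fun ζ s =>
    lintegral_add_left_eq_self (fun v => (Ioc (0 : ℝ) 1).indicator (fun s => hG j R ζ s v) s) s
  simp_rw [e1]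
  rw [← swap3 P (f := fun ζ s v => (Ioc (0 : ℝ) 1).indicator (fun s => hG j R ζ s v) s) hm1]
  simp_rw [stat_step P hstat hgood]
  rw [swap3 P (f := fun ζ s v => (Ioc (0 : ℝ) 1).indicator (fun _ => hG j R ζ s 0) (s + v)) hm3]
  refine lintegral_congr fun ζ => lintegral_congr fun s => ?_
  rw [lintegral_add_left_eq_self (fun v => (Ioc (0 : ℝ) 1).indicator (fun _ => hG j R ζ s 0) v) s,
    lintegral_indicator measurableSet_Ioc]
  simp

lemma palm_step (P Q : Measure (Measure ℝ)) (hgood : ∀ᵐ ζ ∂P, GoodM ζ)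
    (hI0 : intensity P ≠ 0) (hItop : intensity P ≠ ⊤) (hQ : IsPalm P Q) (j : ℕ) (R u : ℝ)
    (hu : R < u) :
    intensity P * Q {η | η (Ioc 0 u) ∈ Ico ((j - 1 : ℕ) : ℝ≥0∞) j} =
    ∫⁻ ζ, ∫⁻ s, (Ioc (0 : ℝ) 1).indicator (fun s => hG j R ζ s (s + u)) s ∂(kap ζ) ∂P := by
  have hE : MeasurableSet {η : Measure ℝ | η (Ioc 0 u) ∈ Ico ((j - 1 : ℕ) : ℝ≥0∞) j} :=
    (Measure.measurable_coe measurableSet_Ioc) measurableSet_Ico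
  rw [← lintegral_indicator_one hE, hQ _ (measurable_one.indicator hE), ← mul_assoc,
    ENNReal.mul_inv_cancel hI0 hItop, one_mul]
  refine lintegral_congr_ae ?_
  filter_upwards [hgood] with ζ h
  rw [kap_eq h, lintegral_indicator measurableSet_Ioc]
  refine lintegral_congr fun s => ?_
  have : shift s ζ ∈ {η : Measure ℝ | η (Ioc 0 u) ∈ Ico ((j - 1 : ℕ) : ℝ≥0∞) j} ↔
      (ζ, s, s + u) ∈ Gset j R := by
    simp only [Gset, mem_ofPred_eq]
    rw [kap_eq h, shift_Ioc, zero_add, add_comm u s]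
    have : s + R ≤ s + u := by linarith
    simp [this]
  unfold hG
  by_cases hm : (ζ, s, s + u) ∈ Gset j R
  · rw [indicator_of_mem hm, indicator_of_mem (this.2 hm)]; rfl
  · rw [indicator_of_notMem hm, indicator_of_notMem (fun h => hm (this.1 h))]

lemma Q_good (P Q : Measure (Measure ℝ)) (hgood : ∀ᵐ ζ ∂P, GoodM ζ) (hQ : IsPalm P Q) :
    ∀ᵐ η ∂Q, GoodM η := by
  have hc := measurableSet_good.compl
  change Q {η | GoodM η}ᶜ = 0
  rw [← lintegral_indicator_one hc, hQ _ (measurable_one.indicator hc)]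
  have : ∫⁻ ζ, ∫⁻ u in Ioc (0 : ℝ) 1, {η | GoodM η}ᶜ.indicator 1 (shift u ζ) ∂ζ ∂P
      = ∫⁻ ζ, (0 : ℝ≥0∞) ∂P := by
    refine lintegral_congr_ae ?_
    filter_upwards [hgood] with ζ h
    have : ∀ u, {η | GoodM η}ᶜ.indicator (1 : Measure ℝ → ℝ≥0∞) (shift u ζ) = 0 := fun u =>
      indicator_of_notMem (not_not.2 (h.shift u)) _
    simp [this]
  rw [this]; simp

lemma Q_diff (Q : Measure (Measure ℝ)) [IsProbabilityMeasure Q] (hgood : ∀ᵐ η ∂Q, GoodM η)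
    (j : ℕ) (hj : 1 ≤ j) (u : ℝ) (hu : 0 ≤ u) :
    Q {η : Measure ℝ | ENNReal.ofReal u < tau j η}
            - Q {η : Measure ℝ | ENNReal.ofReal u < tau (j - 1) η} =
    Q {η | η (Ioc 0 u) ∈ Ico ((j - 1 : ℕ) : ℝ≥0∞) j} := by
  have h1 : ∀ i : ℕ, Q {η : Measure ℝ | ENNReal.ofReal u < tau i η} =
      Q {η : Measure ℝ | η (Ioc 0 u) < i} := by
    intro i
    refine measure_congr ?_
    filter_upwards [hgood] with η h
    exact propext (lt_tau_iff h i hu)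
  rw [h1, h1, ← measure_sdiff]
  · congr 1
    ext η
    simp only [Set.mem_sdiff, mem_ofPred_eq, mem_Ico, not_lt]
    tauto
  · intro η hη
    have hη' : η (Ioc 0 u) < ((j - 1 : ℕ) : ℝ≥0∞) := hη
    exact lt_of_lt_of_le hη' (by exact_mod_cast Nat.sub_le j 1)
  · exact ((Measure.measurable_coe measurableSet_Ioc) measurableSet_Iio).nullMeasurableSet
  · exact measure_ne_top _ _

lemma lhs_step (P : Measure (Measure ℝ)) [IsProbabilityMeasure P]
    (hstat : IsStationaryPP P) (hsimple : IsSimplePP P) (j : ℕ) (hj : 1 ≤ j) (R : ℝ) (hR : 0 ≤ R) :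
    ∫⁻ ζ, ∫⁻ s, hG j R ζ s 0 ∂(kap ζ) ∂P =
    P {ζ : Measure ℝ | ζ ≠ 0 ∧ ENNReal.ofReal R < tau j ζ} := by
  have hms : ∀ a b : ℝ, MeasurableSet {ζ : Measure ℝ | ζ univ ≠ 0 ∧ ζ (Ioc a b) < j} := by
    intro a b
    have h1 : MeasurableSet {ζ : Measure ℝ | ζ univ ≠ 0} :=
      (Measure.measurable_coe MeasurableSet.univ) (measurableSet_singleton (0 : ℝ≥0∞)).compl
    exact h1.inter ((Measure.measurable_coe measurableSet_Ioc) measurableSet_Iio)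
  have e1 : P {ζ : Measure ℝ | ζ ≠ 0 ∧ ENNReal.ofReal R < tau j ζ} =
      P {ζ : Measure ℝ | ζ univ ≠ 0 ∧ ζ (Ioc 0 R) < j} := by
    refine measure_congr ?_
    filter_upwards [hsimple] with ζ h
    have hs : SimpleM ζ := h
    refine propext ?_
    change (ζ ≠ 0 ∧ ENNReal.ofReal R < tau j ζ) ↔ (ζ univ ≠ 0 ∧ ζ (Ioc 0 R) < j)
    rw [lt_tau_iff hs.good j hR, Ne, Ne, Measure.measure_univ_eq_zero]
  have e2 : P {ζ : Measure ℝ | ζ univ ≠ 0 ∧ ζ (Ioc 0 R) < j} =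
      P {ζ : Measure ℝ | ζ univ ≠ 0 ∧ ζ (Ioc (-R) 0) < j} := by
    conv_lhs => rw [← hstat (-R)]
    rw [Measure.map_apply (measurable_shift _) (hms _ _)]
    congr 1
    ext ζ
    simp only [mem_preimage, mem_ofPred_eq]
    rw [shift_Ioc, shift_apply _ _ MeasurableSet.univ]
    simp
  rw [e1, e2, ← lintegral_indicator_one (hms _ _)]
  refine lintegral_congr_ae ?_
  filter_upwards [hsimple, recur P hstat hsimple] with ζ h hrec
  have hs : SimpleM ζ := h
  have hGs : ∀ s, hG j R ζ s 0 =
      {s | s + R ≤ 0 ∧ ζ (Ioc s 0) ∈ Ico ((j - 1 : ℕ) : ℝ≥0∞) j}.indicator 1 s := by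
    intro s
    rw [hG]
    conv_rhs => rw [← kap_eq hs.good]
    rfl
  have hmS : MeasurableSet {s | s + R ≤ 0 ∧ ζ (Ioc s 0) ∈ Ico ((j - 1 : ℕ) : ℝ≥0∞) j} := by
    have : Measurable fun s : ℝ => (ζ, s, (0 : ℝ)) := by fun_prop
    have := this (measurableSet_Gset j R)
    conv => enter [1]; rw [← kap_eq hs.good]
    exact this
  simp_rw [hGs]
  rw [kap_eq hs.good, lintegral_indicator_one hmS]
  rcases hrec with h0 | hinf
  · rw [indicator_of_notMem]
    · simp [h0]
    · rintro ⟨hne, -⟩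
      exact hne (by simp [h0])
  · by_cases hlt : ζ (Ioc (-R) 0) < j
    · rw [path hs hinf hj hR hlt, indicator_of_mem]
      · rfl
      · refine ⟨fun h0 => ?_, hlt⟩
        have := measure_mono_null (subset_univ (Iic (0 : ℝ))) h0
        rw [hinf] at this
        simp at this
    · rw [indicator_of_notMem (fun hh => hlt hh.2)]
      convert measure_empty (μ := ζ)
      rw [eq_empty_iff_forall_notMem]
      rintro s ⟨h1, -, h3⟩
      exact hlt ((measure_mono (Ioc_subset_Ioc_left (by linarith))).trans_lt h3)

/-- Palm–Khinchin equations for the `j`-th entry and return times: for every `j ≥ 1` and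
`R ≥ 0`, `𝔓({ζ : ζ ≠ 0 and τ_j(ζ) > R}) = I ∫_R^∞ (Q(τ_j > u) − Q(τ_{j−1} > u)) du`,
the integrand being nonnegative since `τ_{j−1} ≤ τ_j`. -/
theorem palm_khinchin_jth
    (P Q : Measure (Measure ℝ)) [IsProbabilityMeasure P] [IsProbabilityMeasure Q]
    (hstat : IsStationaryPP P) (hsimple : IsSimplePP P)
    (hI0 : intensity P ≠ 0) (hItop : intensity P ≠ ⊤)
    (hQ : IsPalm P Q) (j : ℕ) (hj : 1 ≤ j) (R : ℝ) (hR : 0 ≤ R) :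
    P {ζ : Measure ℝ | ζ ≠ 0 ∧ ENNReal.ofReal R < tau j ζ}
      = intensity P *
        ∫⁻ u in Set.Ioi R,
          (Q {η : Measure ℝ | ENNReal.ofReal u < tau j η}
            - Q {η : Measure ℝ | ENNReal.ofReal u < tau (j - 1) η}) ∂volume := by
  have hgood : ∀ᵐ ζ ∂P, GoodM ζ := by
    filter_upwards [hsimple] with ζ h
    exact SimpleM.good h
  have hQg := Q_good P Q hgood hQ
  rw [← lhs_step P hstat hsimple j hj R hR, ← main_step P hstat hgood j R,
    ← lintegral_const_mul' _ _ hItop]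
  have hz : ∀ u, u ∉ Ici R →
      ∫⁻ ζ, ∫⁻ s, (Ioc (0 : ℝ) 1).indicator (fun s => hG j R ζ s (s + u)) s ∂(kap ζ) ∂P = 0 := by
    intro u hu
    have hu' : u < R := by simpa using hu
    have : ∀ ζ s, (Ioc (0 : ℝ) 1).indicator (fun s => hG j R ζ s (s + u)) s = 0 := by
      intro ζ s
      have : hG j R ζ s (s + u) = 0 := by
        refine indicator_of_notMem ?_ _
        rintro ⟨h1, -⟩
        have h1' : s + R ≤ s + u := h1
        linarith
      simp [indicator, this]
    simp [this]
  rw [← setLIntegral_eq_of_support_subset (s := Ici R) (fun u hu => by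
    by_contra hn; exact hu (hz u hn)), ← setLIntegral_congr Ioi_ae_eq_Ici]
  refine setLIntegral_congr_fun measurableSet_Ioi fun u hu => ?_
  have hu' : R < u := hu
  rw [Q_diff Q hQg j hj u (by linarith), palm_step P Q hgood hI0 hItop hQ j R u hu']
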